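/- Every formula derivable in Hilbert's 1920 equational system contains at most two occurrences of the implication sign →. -/

import Mathlib

/-- Terms of Hilbert's 1920 equational system: individual variables, the constant 1,
and successor `t+1`. -/
inductive Tm0 where
  | var : ℕ → Tm0
  | one : Tm0
  | succ : Tm0 → Tm0

/-- Formulas of Hilbert's 1920 equational system: equations between terms and
implications between formulas. -/
inductive Fm0 where
  | eq : Tm0 → Tm0 → Fm0
  | imp : Fm0 → Fm0 → Fm0

/-- Derivability in Hilbert's 1920 equational system: all substitution instances
(arbitrary terms replacing the variables) of the four axioms `1 = 1`,
`(a = b) → (a+1 = b+1)`, `(a+1 = b+1) → (a = b)`, and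
`(a = b) → ((a = c) → (b = c))`, closed under modus ponens. -/
inductive Deriv0 : Fm0 → Prop where
  | ax1 : Deriv0 (.eq .one .one)
  | ax2 (a b : Tm0) : Deriv0 ((Fm0.eq a b).imp (.eq a.succ b.succ))
  | ax3 (a b : Tm0) : Deriv0 ((Fm0.eq a.succ b.succ).imp (.eq a b))
  | ax4 (a b c : Tm0) : Deriv0 ((Fm0.eq a b).imp ((Fm0.eq a c).imp (.eq b c)))
  | mp (A B : Fm0) : Deriv0 A → Deriv0 (A.imp B) → Deriv0 B

/-- The number of occurrences of the implication sign `→` in a formula. -/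
def Fm0.impCount : Fm0 → ℕ
  | .eq _ _ => 0
  | .imp A B => A.impCount + B.impCount + 1

/-- Every formula derivable in Hilbert's 1920 equational system contains at most
two occurrences of the implication sign. -/
theorem deriv_impCount_le_two (A : Fm0) (h : Deriv0 A) : A.impCount ≤ 2 := by
  induction h with
  | mp A B _ _ _ hAB =>
    simp only [Fm0.impCount] at hAB
    omega
  | _ => simp [Fm0.impCount]
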